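/- arXiv:1202.5540 — 2 statements merged into one kernel-verified Lean document; each statement's English description precedes it below -/
import Mathlib

section
/- Let G be a group and T a central subgroup of G such that the quotient group G/T is finite; let e denote the exponent of G/T. Assume that the set {t ∈ T : t^e = 1} of e-torsion elements of T is finite. Then G has only finitely many subgroups S with S ∩ T = {1}. -/
/-- If `T` is central of finite index and has only finitely many `n`-torsion elements, then the
whole group has only finitely many elements `x` with `x ^ n = 1`. -/
theorem finite_setOf_pow_eq_one_of_le_center {G : Type*} [Group G] {T : Subgroup G}
    (hT : T ≤ Subgroup.center G) [Finite (G ⧸ T)] {n : ℕ}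
    (htors : {t : G | t ∈ T ∧ t ^ n = 1}.Finite) :
    {x : G | x ^ n = 1}.Finite := by
  have hfiber (q : G ⧸ T) : {x : G | x ^ n = 1 ∧ (x : G ⧸ T) = q}.Finite := by
    rcases Set.eq_empty_or_nonempty {x : G | x ^ n = 1 ∧ (x : G ⧸ T) = q} with h | ⟨x, hx, hxq⟩
    · simp [h]
    · refine (htors.image (x * ·)).subset ?_
      rintro y ⟨hy, hyq⟩
      have hmem : x⁻¹ * y ∈ T := QuotientGroup.eq.mp (hxq.trans hyq.symm)
      have hcomm : Commute x (x⁻¹ * y) := Subgroup.mem_center_iff.mp (hT hmem) x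
      have hpow := hcomm.mul_pow n
      rw [mul_inv_cancel_left, hy, hx, one_mul] at hpow
      exact ⟨x⁻¹ * y, ⟨hmem, hpow.symm⟩, mul_inv_cancel_left x y⟩
  refine (Set.finite_iUnion hfiber).subset fun x hx => ?_
  exact Set.mem_iUnion.mpr ⟨x, hx, rfl⟩

/-- If `T` is a central subgroup of `G` with finite quotient of exponent `e`, and `T` has
only finitely many `e`-torsion elements, then `G` has only finitely many subgroups `S`
with `S ∩ T = {1}`. -/
theorem finitely_many_subgroups_trivial_meet_central
    (G : Type*) [Group G] (T : Subgroup G) (hT : T ≤ Subgroup.center G)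
    [T.Normal] [Finite (G ⧸ T)]
    (htors : {t : G | t ∈ T ∧ t ^ Monoid.exponent (G ⧸ T) = 1}.Finite) :
    {S : Subgroup G | S ⊓ T = ⊥}.Finite := by
  refine Set.Finite.of_finite_image (f := ((↑) : Subgroup G → Set G)) ?_
    SetLike.coe_injective.injOn
  refine (finite_setOf_pow_eq_one_of_le_center hT htors).finite_subsets.subset ?_
  rintro _ ⟨S, hS, rfl⟩ s hs
  have hmem : s ^ Monoid.exponent (G ⧸ T) ∈ S ⊓ T := by
    refine ⟨S.pow_mem hs _, (QuotientGroup.eq_one_iff _).mp ?_⟩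
    rw [QuotientGroup.mk_pow, Monoid.pow_exponent_eq_one]
  rw [show S ⊓ T = ⊥ from hS] at hmem
  exact Subgroup.mem_bot.mp hmem
end

section
/- Let p be a prime and k a field of characteristic different from p that contains a primitive p-th root of unity. For a group G with a central subgroup C, let f(G, C) denote the minimal dimension of a finite-dimensional k-linear representation of G whose restriction to C is injective. For i = 1, 2, let G_i be a group with a central subgroup C_i isomorphic to (ℤ/pℤ)^{r_i} for some r_i ≥ 0, and assume that each G_i admits at least one finite-dimensional k-representation whose restriction to C_i is injective. Then f(G₁ × G₂, C₁ × C₂) = f(G₁, C₁) + f(G₂, C₂), where C₁ × C₂ is viewed as a central subgroup of G₁ × G₂. -/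
/-- The minimal dimension of a finite-dimensional `k`-linear representation of `G`
whose restriction to the subgroup `C` is injective.  (Every `n`-dimensional
representation is isomorphic to one on `Fin n → k`.) -/
noncomputable def minFaithfulDim (k : Type) [Field k] (G : Type) [Group G]
    (C : Subgroup G) : ℕ :=
  sInf {n : ℕ | ∃ ρ : Representation k G (Fin n → k),
    Function.Injective fun c : C => ρ (c : G)}

open Module Matrix

section LinearAlgebra

variable {F ι : Type*} [Field F] [Fintype ι] [DecidableEq ι]

/-- A set of vectors with no common nonzero orthogonal vector contains the rows of an
invertible matrix. -/
lemma exists_matrix_det_ne_zero_of_separating (S : Set (ι → F))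
    (hS : ∀ m : ι → F, (∀ a ∈ S, a ⬝ᵥ m = 0) → m = 0) :
    ∃ A : Matrix ι ι F, (∀ i, A i ∈ S) ∧ A.det ≠ 0 := by
  have hspan : Submodule.span F S = ⊤ := by
    by_contra hne
    obtain ⟨f, hf, hle⟩ := Submodule.exists_le_ker_of_lt_top _ (lt_top_iff_ne_top.2 hne)
    have hfa : ∀ a, f a = a ⬝ᵥ fun i => f (Pi.single i 1) := by
      intro a
      simp only [dotProduct]
      conv_lhs => rw [pi_eq_sum_univ' a]
      simp only [map_sum, map_smul, smul_eq_mul]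
    have h0 := hS _ fun a ha => (hfa a).symm.trans (hle (Submodule.subset_span ha))
    exact hf (LinearMap.ext fun a => by rw [hfa a, h0]; simp)
  obtain ⟨b, hbS, hb, hli⟩ := exists_linearIndependent F S
  let B : Basis b F (ι → F) := Basis.mk hli (by rw [Subtype.range_coe, hb, hspan])
  let e : ι ≃ b := (Pi.basisFun F ι).indexEquiv B
  refine ⟨fun i => (e i : ι → F), fun i => hbS (e i).2, ?_⟩
  have hrows : LinearIndependent F fun i => (e i : ι → F) := hli.comp e e.injective
  exact ((Matrix.isUnit_iff_isUnit_det _).1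
    (Matrix.linearIndependent_rows_iff_isUnit.1 hrows)).ne_zero

/-- If a sum of two matrices is invertible, then some matrix obtained by choosing each row from
one of the two summands is invertible. -/
lemma exists_det_piecewise_ne_zero (A B : Matrix ι ι F) (h : (A + B).det ≠ 0) :
    ∃ s : Finset ι, (Matrix.det (s.piecewise A B : ι → ι → F)) ≠ 0 := by
  by_contra! hs
  refine h ?_
  have := (Matrix.detRowAlternating (R := F) (n := ι)).map_add_univ A B
  exact this.trans (Finset.sum_eq_zero fun s _ => hs s)

end LinearAlgebra

/-- Rows of an invertible matrix indexed by a disjoint union can be partitioned so that the first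
part is nondegenerate on the first summand and the second part on the second summand. -/
lemma exists_rows_partition {F κ₁ κ₂ : Type*} [Field F] [Fintype κ₁] [Fintype κ₂]
    [DecidableEq κ₁] [DecidableEq κ₂] (A : Matrix (κ₁ ⊕ κ₂) (κ₁ ⊕ κ₂) F) (hA : A.det ≠ 0) :
    ∃ s : Set (κ₁ ⊕ κ₂),
      (∀ m : κ₁ → F, (∀ i ∈ s, A i ⬝ᵥ Sum.elim m 0 = 0) → m = 0) ∧
      (∀ m : κ₂ → F, (∀ i ∈ sᶜ, A i ⬝ᵥ Sum.elim 0 m = 0) → m = 0) := by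
  let B : Matrix (κ₁ ⊕ κ₂) (κ₁ ⊕ κ₂) F := fun i => Sum.elim (A i ∘ Sum.inl) 0
  let C : Matrix (κ₁ ⊕ κ₂) (κ₁ ⊕ κ₂) F := fun i => Sum.elim 0 (A i ∘ Sum.inr)
  have hBC : A = B + C := by
    ext i (j | j) <;> rw [Matrix.add_apply] <;> simp [B, C]
  obtain ⟨s, hs⟩ := exists_det_piecewise_ne_zero B C (hBC ▸ hA)
  refine ⟨s, fun m hm => ?_, fun m hm => ?_⟩
  · have h0 : Sum.elim m (0 : κ₂ → F) = 0 := by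
      refine Matrix.eq_zero_of_mulVec_eq_zero hs (funext fun i => ?_)
      by_cases hi : i ∈ s
      · have := hm i hi
        simp only [Matrix.mulVec, Finset.piecewise, hi, if_true, Pi.zero_apply]
        simpa [B, dotProduct] using this
      · simp [Matrix.mulVec, Finset.piecewise, hi, C, dotProduct]
    exact funext fun j => congrFun h0 (Sum.inl j)
  · have h0 : Sum.elim (0 : κ₁ → F) m = 0 := by
      refine Matrix.eq_zero_of_mulVec_eq_zero hs (funext fun i => ?_)
      by_cases hi : i ∈ s
      · simp [Matrix.mulVec, Finset.piecewise, hi, B, dotProduct]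
      · have := hm i (by simpa using hi)
        simp only [Matrix.mulVec, Finset.piecewise, hi, if_false, Pi.zero_apply]
        simpa [C, dotProduct] using this
    exact funext fun j => congrFun h0 (Sum.inr j)

section WeightSpace

variable {p : ℕ} {k V ι : Type*} [Field k] [AddCommGroup V] [Module k V]
  [Fintype ι] (ψ : AddChar (ZMod p) k)
  (T : Representation k (Multiplicative (ι → ZMod p)) V)

/-- The subspace on which `m` acts through the character `m ↦ ψ (a ⬝ᵥ m)`. -/
def weightSpace (a : ι → ZMod p) : Submodule k V :=
  ⨅ m : ι → ZMod p, Module.End.eigenspace (T (Multiplicative.ofAdd m)) (ψ (a ⬝ᵥ m))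

variable {ψ T}

lemma mem_weightSpace {a : ι → ZMod p} {v : V} :
    v ∈ weightSpace ψ T a ↔ ∀ m, T (Multiplicative.ofAdd m) v = ψ (a ⬝ᵥ m) • v := by
  simp [weightSpace]

lemma weightSpace_le_comap_of_commute {f : Module.End k V} (hf : ∀ m, Commute f (T m))
    (a : ι → ZMod p) : weightSpace ψ T a ≤ (weightSpace ψ T a).comap f := by
  intro v hv
  rw [Submodule.mem_comap, mem_weightSpace]
  intro m
  rw [← Module.End.mul_apply, ← (hf _).eq, Module.End.mul_apply, mem_weightSpace.1 hv, map_smul]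

lemma iSupIndep_weightSpace (hψ : ∀ a, ψ a = 1 → a = 0) :
    iSupIndep (weightSpace ψ T) := by
  classical
  have hind := Module.End.independent_iInf_maxGenEigenspace_of_forall_mapsTo
    (fun m : ι → ZMod p => T (Multiplicative.ofAdd m)) fun i j φ =>
      Module.End.mapsTo_maxGenEigenspace_of_comm
        (show Commute (T (Multiplicative.ofAdd j)) (T (Multiplicative.ofAdd i)) from
          (Commute.all _ _).map T) φ
  have hinj : Function.Injective fun (a m : ι → ZMod p) => ψ (a ⬝ᵥ m) := by
    intro a b hab
    refine funext fun i => sub_eq_zero.1 (hψ _ ?_)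
    have := congrFun hab (Pi.single i 1)
    simp only [dotProduct_single, mul_one] at this
    rw [AddChar.map_sub_eq_div, this, div_self]
    exact (ψ.val_isUnit (b i)).ne_zero
  exact (hind.comp hinj).mono fun a =>
    iInf_mono fun m => Module.End.eigenspace_le_maxGenEigenspace

variable [Fact p.Prime]

lemma sum_addChar_neg_dotProduct (hψ : ∀ a, ψ a = 1 → a = 0) [DecidableEq ι] (m : ι → ZMod p) :
    ∑ a : ι → ZMod p, ψ (-(a ⬝ᵥ m)) =
      if m = 0 then (Fintype.card (ι → ZMod p) : k) else 0 := by
  split_ifs with hm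
  · simp [hm]
  · let χ : AddChar (ι → ZMod p) k :=
      ψ.compAddMonoidHom (AddMonoidHom.mk' (fun a => -(a ⬝ᵥ m)) fun a b => by
        rw [add_dotProduct, neg_add])
    refine AddChar.sum_eq_zero_of_ne_one (ψ := χ) fun hχ => hm (funext fun i => ?_)
    have : ψ (-(Pi.single i 1 ⬝ᵥ m)) = 1 := DFunLike.congr_fun hχ (Pi.single i 1)
    simpa using hψ _ this

lemma iSup_weightSpace (hψ : ∀ a, ψ a = 1 → a = 0) (hp : (p : k) ≠ 0) :
    ⨆ a, weightSpace ψ T a = ⊤ := by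
  classical
  rw [eq_top_iff]
  intro v _
  let N : k := Fintype.card (ι → ZMod p)
  have hN : N ≠ 0 := by simp [N, ZMod.card, hp]
  let w (a : ι → ZMod p) : V :=
    ∑ m : ι → ZMod p, ψ (-(a ⬝ᵥ m)) • T (Multiplicative.ofAdd m) v
  have hw : ∀ a, w a ∈ weightSpace ψ T a := by
    intro a
    rw [mem_weightSpace]
    intro m'
    simp only [w, map_sum, map_smul, Finset.smul_sum]
    refine Fintype.sum_equiv (Equiv.addLeft m') _ _ fun m => ?_
    rw [Equiv.coe_addLeft, ofAdd_add, map_mul, Module.End.mul_apply, smul_smul,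
      ← AddChar.map_add_eq_mul, dotProduct_add]
    congr 2
    abel
  have hsum : ∑ a, w a = N • v := by
    simp only [w]
    rw [Finset.sum_comm]
    simp_rw [← Finset.sum_smul, sum_addChar_neg_dotProduct hψ, ite_smul, zero_smul]
    simp [N]
  have hv : v = N⁻¹ • ∑ a, w a := by rw [hsum, inv_smul_smul₀ hN]
  rw [hv]
  exact Submodule.smul_mem _ _
    (Submodule.sum_mem _ fun a _ => Submodule.mem_iSup_of_mem a (hw a))

lemma eq_zero_of_forall_weightSpace (hψ : ∀ a, ψ a = 1 → a = 0) (hp : (p : k) ≠ 0)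
    (hT : Function.Injective T) (m : ι → ZMod p)
    (hm : ∀ a, weightSpace ψ T a ≠ ⊥ → a ⬝ᵥ m = 0) : m = 0 := by
  suffices h : T (Multiplicative.ofAdd m) = 1 from
    Multiplicative.ofAdd.injective (hT (h.trans T.map_one.symm))
  have hle : (⊤ : Submodule k V) ≤ LinearMap.eqLocus (T (Multiplicative.ofAdd m)) 1 := by
    rw [← iSup_weightSpace (T := T) hψ hp]
    refine iSup_le fun a v hv => ?_
    rw [LinearMap.mem_eqLocus, mem_weightSpace.1 hv, Module.End.one_apply]
    by_cases ha : weightSpace ψ T a = ⊥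
    · rw [ha, Submodule.mem_bot] at hv
      simp [hv]
    · rw [hm a ha, AddChar.map_zero_eq_one, one_smul]
  exact LinearMap.ext fun v => hle trivial

lemma dotProduct_eq_zero_of_weightSpace (hψ : ∀ a, ψ a = 1 → a = 0) {a m : ι → ZMod p}
    (ha : weightSpace ψ T a ≠ ⊥)
    (hm : ∀ v ∈ weightSpace ψ T a, T (Multiplicative.ofAdd m) v = v) : a ⬝ᵥ m = 0 := by
  obtain ⟨v, hv, hv0⟩ := Submodule.exists_mem_ne_zero_of_ne_bot ha
  refine hψ _ (smul_left_injective k hv0 ?_)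
  simp only [one_smul, ← mem_weightSpace.1 hv m, hm v hv]

end WeightSpace

section MinFaithfulDim

variable {k : Type} [Field k] {G : Type} [Group G] {C : Subgroup G}

lemma exists_representation_pi_fin {V : Type*} [AddCommGroup V] [Module k V]
    [FiniteDimensional k V] (ρ : Representation k G V) (h : ∀ c ∈ C, ρ c = 1 → c = 1) :
    ∃ σ : Representation k G (Fin (finrank k V) → k),
      Function.Injective fun c : C => σ (c : G) := by
  let e : Module.End k V ≃+* Module.End k (Fin (finrank k V) → k) :=
    (finBasis k V).equivFun.conjRingEquiv
  let σ : Representation k G (Fin (finrank k V) → k) := (e : _ →* _).comp ρ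
  refine ⟨σ, (injective_iff_map_eq_one (σ.comp C.subtype)).2 fun c hc => ?_⟩
  exact Subtype.ext (h c c.2 (e.injective (hc.trans (map_one e).symm)))

lemma minFaithfulDim_le_finrank {V : Type*} [AddCommGroup V] [Module k V] [FiniteDimensional k V]
    (ρ : Representation k G V) (h : ∀ c ∈ C, ρ c = 1 → c = 1) :
    minFaithfulDim k G C ≤ finrank k V :=
  Nat.sInf_le (exists_representation_pi_fin ρ h)

lemma exists_representation_minFaithfulDim
    (h : ∃ n : ℕ, ∃ ρ : Representation k G (Fin n → k),
      Function.Injective fun c : C => ρ (c : G)) :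
    ∃ ρ : Representation k G (Fin (minFaithfulDim k G C) → k),
      ∀ c ∈ C, ρ c = 1 → c = 1 := by
  obtain ⟨ρ, hρ⟩ := Nat.sInf_mem h
  refine ⟨ρ, fun c hc h1 => ?_⟩
  exact congrArg Subtype.val (@hρ ⟨c, hc⟩ 1 (h1.trans ρ.map_one.symm))

lemma minFaithfulDim_le_finrank_of_le_comap {V M : Type*} [AddCommGroup V] [Module k V]
    [FiniteDimensional k V] [AddGroup M]
    (ρ : Representation k G V) (e : Multiplicative M ≃* C) (W : Submodule k V)
    (hW : ∀ g, W ≤ W.comap (ρ g))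
    (h : ∀ m : M, (∀ v ∈ W, ρ (e (Multiplicative.ofAdd m)) v = v) → m = 0) :
    minFaithfulDim k G C ≤ finrank k W := by
  refine minFaithfulDim_le_finrank (ρ.subrepresentation W hW) fun c hc h1 => ?_
  have hm : Multiplicative.toAdd (e.symm ⟨c, hc⟩) = 0 := by
    refine h _ fun v hv => ?_
    rw [ofAdd_toAdd, MulEquiv.apply_symm_apply]
    exact congrArg Subtype.val (LinearMap.congr_fun h1 ⟨v, hv⟩)
  have : e.symm ⟨c, hc⟩ = 1 := hm
  exact congrArg Subtype.val (e.symm.map_eq_one_iff.1 this)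

end MinFaithfulDim

lemma exists_representation_prod {k V₁ V₂ : Type*} [Field k] [AddCommGroup V₁] [Module k V₁]
    [AddCommGroup V₂] [Module k V₂] {G₁ G₂ : Type*} [Group G₁] [Group G₂]
    {C₁ : Subgroup G₁} {C₂ : Subgroup G₂}
    (ρ₁ : Representation k G₁ V₁) (h₁ : ∀ c ∈ C₁, ρ₁ c = 1 → c = 1)
    (ρ₂ : Representation k G₂ V₂) (h₂ : ∀ c ∈ C₂, ρ₂ c = 1 → c = 1) :
    ∃ ρ : Representation k (G₁ × G₂) (V₁ × V₂), ∀ c ∈ C₁.prod C₂, ρ c = 1 → c = 1 := by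
  refine ⟨Representation.prod (ρ₁.comp (MonoidHom.fst G₁ G₂)) (ρ₂.comp (MonoidHom.snd G₁ G₂)),
    fun c hc h => ?_⟩
  refine Prod.ext (h₁ _ hc.1 (LinearMap.ext fun v => ?_)) (h₂ _ hc.2 (LinearMap.ext fun v => ?_))
  · exact congrArg Prod.fst (LinearMap.congr_fun h (v, 0))
  · exact congrArg Prod.snd (LinearMap.congr_fun h (0, v))

lemma add_minFaithfulDim_le_finrank {p : ℕ} [Fact p.Prime] {k : Type} [Field k] (hp : (p : k) ≠ 0)
    {ψ : AddChar (ZMod p) k} (hψ : ∀ a, ψ a = 1 → a = 0)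
    {G₁ G₂ : Type} [Group G₁] [Group G₂] {C₁ : Subgroup G₁} {C₂ : Subgroup G₂}
    (hc₁ : C₁ ≤ Subgroup.center G₁) (hc₂ : C₂ ≤ Subgroup.center G₂)
    {κ₁ κ₂ : Type*} [Fintype κ₁] [Fintype κ₂]
    (e₁ : Multiplicative (κ₁ → ZMod p) ≃* C₁) (e₂ : Multiplicative (κ₂ → ZMod p) ≃* C₂)
    {V : Type*} [AddCommGroup V] [Module k V] [FiniteDimensional k V]
    (ρ : Representation k (G₁ × G₂) V) (hρ : ∀ c ∈ C₁.prod C₂, ρ c = 1 → c = 1) :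
    minFaithfulDim k G₁ C₁ + minFaithfulDim k G₂ C₂ ≤ finrank k V := by
  classical
  let φ : Multiplicative (κ₁ ⊕ κ₂ → ZMod p) →* G₁ × G₂ :=
    ((C₁.subtype.comp e₁.toMonoidHom).comp
        (LinearMap.funLeft (ZMod p) (ZMod p) Sum.inl).toAddMonoidHom.toMultiplicative).prod
      ((C₂.subtype.comp e₂.toMonoidHom).comp
        (LinearMap.funLeft (ZMod p) (ZMod p) Sum.inr).toAddMonoidHom.toMultiplicative)
  have hφ : ∀ m : κ₁ ⊕ κ₂ → ZMod p, φ (Multiplicative.ofAdd m) =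
      ((e₁ (Multiplicative.ofAdd (m ∘ Sum.inl)) : G₁),
        (e₂ (Multiplicative.ofAdd (m ∘ Sum.inr)) : G₂)) := fun m => rfl
  have hφC : ∀ m, φ m ∈ C₁.prod C₂ := fun m => ⟨SetLike.coe_mem _, SetLike.coe_mem _⟩
  let T : Representation k (Multiplicative (κ₁ ⊕ κ₂ → ZMod p)) V := ρ.comp φ
  have hT : Function.Injective T := by
    refine (injective_iff_map_eq_one T).2 fun m hm => ?_
    have h1 : φ m = 1 := hρ _ (hφC m) hm
    have hm₁ := e₁.map_eq_one_iff.1 (Subtype.ext (congrArg Prod.fst h1))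
    have hm₂ := e₂.map_eq_one_iff.1 (Subtype.ext (congrArg Prod.snd h1))
    refine Multiplicative.toAdd.injective (funext fun i => ?_)
    rcases i with i | i
    · exact congrFun (congrArg Multiplicative.toAdd hm₁) i
    · exact congrFun (congrArg Multiplicative.toAdd hm₂) i
  have hcomm : ∀ g m, Commute (ρ g) (T m) := fun g m =>
    Commute.map (Prod.ext (Subgroup.mem_center_iff.1 (hc₁ (hφC m).1) g.1)
      (Subgroup.mem_center_iff.1 (hc₂ (hφC m).2) g.2)) ρ
  obtain ⟨A, hAmem, hA⟩ := exists_matrix_det_ne_zero_of_separating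
    {a | weightSpace ψ T a ≠ ⊥} (eq_zero_of_forall_weightSpace hψ hp hT)
  obtain ⟨s, hs₁, hs₂⟩ := exists_rows_partition A hA
  let W (t : Set (κ₁ ⊕ κ₂)) : Submodule k V := ⨆ i ∈ t, weightSpace ψ T (A i)
  have hW : ∀ t g, W t ≤ (W t).comap (ρ g) := fun t g =>
    iSup₂_le fun i hi => (weightSpace_le_comap_of_commute (hcomm g) _).trans
      (Submodule.comap_mono (le_iSup₂_of_le i hi le_rfl))
  have hzero : ∀ t m, (∀ v ∈ W t, T (Multiplicative.ofAdd m) v = v) →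
      ∀ i ∈ t, A i ⬝ᵥ m = 0 := fun t m hm i hi =>
    dotProduct_eq_zero_of_weightSpace hψ (hAmem i) fun v hv =>
      hm v (le_iSup₂_of_le (f := fun i _ => weightSpace ψ T (A i)) i hi le_rfl hv)
  have hle₁ : minFaithfulDim k G₁ C₁ ≤ finrank k (W s) := by
    refine minFaithfulDim_le_finrank_of_le_comap (ρ.comp (MonoidHom.inl G₁ G₂)) e₁ (W s)
      (fun g => hW s _) fun m hm => hs₁ m (hzero s _ fun v hv => ?_)
    have : φ (Multiplicative.ofAdd (Sum.elim m 0)) =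
        ((e₁ (Multiplicative.ofAdd m) : G₁), 1) := by
      rw [hφ, Sum.elim_comp_inl, Sum.elim_comp_inr, ofAdd_zero, map_one, OneMemClass.coe_one]
    exact (congrArg (fun g => ρ g v) this).trans (hm v hv)
  have hle₂ : minFaithfulDim k G₂ C₂ ≤ finrank k (W sᶜ) := by
    refine minFaithfulDim_le_finrank_of_le_comap (ρ.comp (MonoidHom.inr G₁ G₂)) e₂ (W sᶜ)
      (fun g => hW sᶜ _) fun m hm => hs₂ m (hzero sᶜ _ fun v hv => ?_)
    have : φ (Multiplicative.ofAdd (Sum.elim 0 m)) =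
        (1, (e₂ (Multiplicative.ofAdd m) : G₂)) := by
      rw [hφ, Sum.elim_comp_inl, Sum.elim_comp_inr, ofAdd_zero, map_one, OneMemClass.coe_one]
    exact (congrArg (fun g => ρ g v) this).trans (hm v hv)
  have hAinj : Function.Injective A :=
    (Matrix.linearIndependent_rows_iff_isUnit.2
      ((Matrix.isUnit_iff_isUnit_det A).2 hA.isUnit)).injective
  have hdisj : Disjoint (W s) (W sᶜ) :=
    ((iSupIndep_weightSpace (T := T) hψ).comp hAinj).disjoint_biSup_biSup disjoint_compl_right
  exact (add_le_add hle₁ hle₂).trans (Submodule.finrank_add_finrank_le_of_disjoint hdisj)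

/-- Additivity: for central subgroups `Cᵢ ≅ (ℤ/pℤ)^{rᵢ}` of `Gᵢ` (over a field of
characteristic `≠ p` containing a primitive `p`-th root of unity),
`f(G₁ × G₂, C₁ × C₂) = f(G₁, C₁) + f(G₂, C₂)`. -/
theorem minFaithfulDim_additive
    (p : ℕ) (hp : p.Prime) (k : Type) [Field k] (hchar : ringChar k ≠ p)
    (hroot : ∃ ζ : k, IsPrimitiveRoot ζ p)
    (G₁ G₂ : Type) [Group G₁] [Group G₂]
    (C₁ : Subgroup G₁) (C₂ : Subgroup G₂)
    (hc₁ : C₁ ≤ Subgroup.center G₁) (hc₂ : C₂ ≤ Subgroup.center G₂)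
    (r₁ r₂ : ℕ)
    (hiso₁ : Nonempty (C₁ ≃* (Fin r₁ → Multiplicative (ZMod p))))
    (hiso₂ : Nonempty (C₂ ≃* (Fin r₂ → Multiplicative (ZMod p))))
    (hne₁ : ∃ n : ℕ, ∃ ρ : Representation k G₁ (Fin n → k),
      Function.Injective fun c : C₁ => ρ (c : G₁))
    (hne₂ : ∃ n : ℕ, ∃ ρ : Representation k G₂ (Fin n → k),
      Function.Injective fun c : C₂ => ρ (c : G₂)) :
    minFaithfulDim k (G₁ × G₂) (C₁.prod C₂) =
      minFaithfulDim k G₁ C₁ + minFaithfulDim k G₂ C₂ := by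
  have : Fact p.Prime := ⟨hp⟩
  obtain ⟨ζ, hζ⟩ := hroot
  have hpk : (p : k) ≠ 0 := fun h =>
    (hp.eq_one_or_self_of_dvd _ (ringChar.dvd h)).elim CharP.ringChar_ne_one hchar
  have hψ : ∀ a, AddChar.zmodChar p hζ.pow_eq_one a = 1 → a = 0 := fun a =>
    ((AddChar.zmodChar_primitive_of_primitive_root p hζ).zmod_char_eq_one_iff p a).1
  obtain ⟨e₁⟩ := hiso₁
  obtain ⟨e₂⟩ := hiso₂
  obtain ⟨ρ₁, h₁⟩ := exists_representation_minFaithfulDim hne₁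
  obtain ⟨ρ₂, h₂⟩ := exists_representation_minFaithfulDim hne₂
  obtain ⟨ρ, h⟩ := exists_representation_prod ρ₁ h₁ ρ₂ h₂
  refine le_antisymm ((minFaithfulDim_le_finrank ρ h).trans_eq (by simp)) ?_
  obtain ⟨σ, hσ⟩ := exists_representation_minFaithfulDim ⟨_, exists_representation_pi_fin ρ h⟩
  simpa using add_minFaithfulDim_le_finrank hpk hψ hc₁ hc₂
    ((MulEquiv.funMultiplicative _ (ZMod p)).trans e₁.symm)
    ((MulEquiv.funMultiplicative _ (ZMod p)).trans e₂.symm) σ hσ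
end
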